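/- arXiv:1611.00052 — 2 statements merged into one kernel-verified Lean document; each statement's English description precedes it below -/
import Mathlib

section
/- There is a universal constant C such that the following holds. Let (X,d) be a metric space and r ∈ X. Then there exists an online routing algorithm A — a function that assigns to every finite sequence (v_1,…,v_t) of points of X a path P_t from v_t to r, with outputs on a prefix coinciding with those on the full sequence — such that for every input sequence v_1,…,v_k of k ≥ 1 terminals and every nondecreasing concave function f : [0,∞) → [0,∞) with f(0) = 0, cost_f(P) ≤ C·(1 + log₂ k)^{5/2}·OPT_f. -/
open MeasureTheory
open scoped Classical ENNReal

noncomputable section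

variable {X : Type*} [MetricSpace X]

/-- The length of an unordered pair of points: the distance between its endpoints. -/
def edgeLen (e : Sym2 X) : ℝ :=
  Sym2.lift ⟨fun x y => dist x y, fun x y => dist_comm x y⟩ e

/-- The edges of a path: the unordered pairs of consecutive points. -/
def edgeList (p : List X) : List (Sym2 X) :=
  (p.zip p.tail).map fun ab => s(ab.1, ab.2)

/-- `p` is a path from `v` to `r`: a finite sequence of points starting at `v`
and ending at `r`. -/
def IsPath (v r : X) (p : List X) : Prop :=
  p.head? = some v ∧ p.getLast? = some r

/-- All edges occurring in some path of a routing. -/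
def allEdges {k : ℕ} (P : Fin k → List X) : Finset (Sym2 X) :=
  Finset.univ.biUnion fun s => (edgeList (P s)).toFinset

/-- The load of an edge `e` under a routing `P`: the number of indices `s`
such that `e` is an edge of `P s`. -/
def load {k : ℕ} (P : Fin k → List X) (e : Sym2 X) : ℕ :=
  (Finset.univ.filter fun s => e ∈ edgeList (P s)).card

/-- The cost of a routing `P` under the cost function `f`:
`∑_{e : load_e(P) > 0} d(e) · f(load_e(P))`. -/
def costf {k : ℕ} (f : ℝ → ℝ) (P : Fin k → List X) : ℝ :=
  ∑ e ∈ allEdges P, edgeLen e * f (load P e)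

/-- The optimal cost, under `f`, of routing the terminals `v` to the root `r`. -/
def OPTf {k : ℕ} (f : ℝ → ℝ) (v : Fin k → X) (r : X) : ℝ :=
  sInf { c | ∃ P : Fin k → List X, (∀ s, IsPath (v s) r (P s)) ∧ c = costf f P }

lemma edgeLen_mk (x y : X) : edgeLen s(x, y) = dist x y := rfl

lemma edgeLen_nonneg (e : Sym2 X) : 0 ≤ edgeLen e := by
  induction e with
  | h x y => exact dist_nonneg

/-- The variation of a real function along an unordered pair. -/
def edgeVar (φ : X → ℝ) (e : Sym2 X) : ℝ :=
  Sym2.lift ⟨fun x y => |φ x - φ y|, fun x y => abs_sub_comm (φ x) (φ y)⟩ e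

lemma edgeVar_mk (φ : X → ℝ) (x y : X) : edgeVar φ s(x, y) = |φ x - φ y| := rfl

lemma edgeVar_nonneg (φ : X → ℝ) (e : Sym2 X) : 0 ≤ edgeVar φ e := by
  induction e with
  | h x y => exact abs_nonneg _

lemma edgeList_cons_cons (x y : X) (l : List X) :
    edgeList (x :: y :: l) = s(x, y) :: edgeList (y :: l) := rfl

lemma edgeList_append_subset (l₁ l₂ : List X) : edgeList l₂ ⊆ edgeList (l₁ ++ l₂) := by
  induction l₁ with
  | nil => simp
  | cons a l₁ ih =>
    intro e he
    have h := ih he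
    rcases hl : l₁ ++ l₂ with _ | ⟨b, l⟩
    · rw [hl] at h
      simp [edgeList] at h
    · rw [hl] at h
      rw [List.cons_append, hl, edgeList_cons_cons]
      exact List.mem_cons_of_mem _ h

lemma mem_of_mem_edgeList {l : List X} {x y : X} (h : s(x, y) ∈ edgeList l) : x ∈ l := by
  induction l with
  | nil => simp [edgeList] at h
  | cons a l ih =>
    rcases l with _ | ⟨b, l⟩
    · simp [edgeList] at h
    · rw [edgeList_cons_cons, List.mem_cons] at h
      rcases h with h | h
      · rw [Sym2.eq_iff] at h
        rcases h with h | h <;> simp [h.1]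
      · exact List.mem_cons_of_mem _ (ih h)

/-- The distinct edges of a path from `v` to `r` carry a total variation of at least
`φ r - φ v`. -/
lemma sub_le_sum_edgeVar (φ : X → ℝ) (n : ℕ) : ∀ (p : List X) (v r : X), p.length ≤ n →
    IsPath v r p → φ r - φ v ≤ ∑ e ∈ (edgeList p).toFinset, edgeVar φ e := by
  induction n with
  | zero =>
    intro p v r hp h
    have : p = [] := List.length_eq_zero_iff.mp (by omega)
    simp [this, IsPath] at h
  | succ n ih =>
    intro p v r hp h
    rcases p with _ | ⟨a, l⟩
    · simp [IsPath] at h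
    obtain ⟨h1, h2⟩ := h
    obtain rfl : a = v := by simpa using h1
    rcases l with _ | ⟨b, l⟩
    · obtain rfl : a = r := by simpa using h2
      simp [edgeList]
    have h2' : (b :: l).getLast? = some r := by simpa using h2
    by_cases ha : a ∈ b :: l
    · obtain ⟨l₁, l₂, hl⟩ := List.append_of_mem ha
      have hlen : (a :: l₂).length ≤ n := by
        have := congrArg List.length hl
        simp only [List.length_append, List.length_cons] at this hp ⊢
        omega
      have hp2 : IsPath a r (a :: l₂) := by
        refine ⟨rfl, ?_⟩
        rw [hl] at h2'
        simpa [List.getLast?_append] using h2'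
      refine (ih _ _ _ hlen hp2).trans ?_
      refine Finset.sum_le_sum_of_subset_of_nonneg ?_ fun e _ _ => edgeVar_nonneg φ e
      intro e he
      rw [List.mem_toFinset] at he ⊢
      rw [edgeList_cons_cons, hl]
      exact List.mem_cons_of_mem _ (edgeList_append_subset _ _ he)
    · have hne : s(a, b) ∉ (edgeList (b :: l)).toFinset := by
        rw [List.mem_toFinset]
        exact fun h => ha (mem_of_mem_edgeList h)
      rw [edgeList_cons_cons, List.toFinset_cons, Finset.sum_insert hne, edgeVar_mk]
      have h3 := ih (b :: l) b r (by simpa using hp) ⟨rfl, h2'⟩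
      have h4 := neg_abs_le (φ a - φ b)
      linarith

lemma load_le {k : ℕ} (P : Fin k → List X) (e : Sym2 X) : load P e ≤ k := by
  unfold load
  exact (Finset.card_filter_le _ _).trans (by simp)

lemma mem_allEdges {k : ℕ} {P : Fin k → List X} {e : Sym2 X} :
    e ∈ allEdges P ↔ ∃ s, e ∈ edgeList (P s) := by
  simp [allEdges]

/-- If at most `M` members of `Q` are close to any given member, every routing pays `ρ`
for each member of `Q`, up to a factor `2`. -/
lemma card_mul_le_cost {k : ℕ} {v : Fin k → X} {r : X} {P : Fin k → List X}
    (hP : ∀ s, IsPath (v s) r (P s)) (M : ℕ) (ρ : ℝ) (hρ : 0 ≤ ρ) (Q : Finset (Fin k))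
    (hQ : ∀ s ∈ Q, (Q.filter fun s' => dist (v s') (v s) < 2 * ρ).card ≤ M)
    (hr : ∀ s ∈ Q, ρ ≤ dist (v s) r) :
    (Q.card : ℝ) * ρ ≤ 2 * costf (fun x => min x (M : ℝ)) P := by
  set φ : Fin k → X → ℝ := fun s z => min (dist (v s) z) ρ with hφ
  have h1 : ∀ s ∈ Q, ρ ≤ ∑ e ∈ (edgeList (P s)).toFinset, edgeVar (φ s) e := by
    intro s hs
    have := sub_le_sum_edgeVar (φ s) _ (P s) (v s) r le_rfl (hP s)
    have h2 : φ s r = ρ := min_eq_right (hr s hs)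
    have h3 : φ s (v s) = 0 := by simp [hφ, hρ]
    rw [h2, h3] at this
    linarith
  have hball : ∀ y : X, (Q.filter fun s => dist (v s) y < ρ).card ≤ M := by
    intro y
    rcases (Q.filter fun s => dist (v s) y < ρ).eq_empty_or_nonempty with h | ⟨s, hs⟩
    · simp [h]
    · refine le_trans (Finset.card_le_card ?_) (hQ s (Finset.mem_filter.mp hs).1)
      intro s' hs'
      rw [Finset.mem_filter] at hs hs' ⊢
      refine ⟨hs'.1, ?_⟩
      have := dist_triangle_right (v s') (v s) y
      linarith [hs.2, hs'.2]
  have h2 : ∀ e ∈ allEdges P, ∑ s ∈ Q.filter (fun s => e ∈ edgeList (P s)), edgeVar (φ s) e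
      ≤ 2 * (edgeLen e * min (load P e : ℝ) (M : ℝ)) := by
    intro e _
    have hlen : ∀ s, edgeVar (φ s) e ≤ edgeLen e := by
      intro s
      induction e with
      | h x y =>
        rw [edgeVar_mk, edgeLen_mk]
        refine (abs_min_sub_min_le_max _ _ _ _).trans ?_
        simp only [sub_self, abs_zero]
        refine max_le ?_ dist_nonneg
        rw [dist_comm (v s) x, dist_comm (v s) y]
        exact abs_dist_sub_le x y (v s)
    have hA : ∑ s ∈ Q.filter (fun s => e ∈ edgeList (P s)), edgeVar (φ s) e
        ≤ load P e * edgeLen e := by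
      refine (Finset.sum_le_card_nsmul _ _ _ fun s _ => hlen s).trans ?_
      rw [nsmul_eq_mul]
      refine mul_le_mul_of_nonneg_right ?_ (edgeLen_nonneg e)
      exact_mod_cast Finset.card_le_card (Finset.filter_subset_filter _ (Finset.subset_univ Q))
    have hB : ∑ s ∈ Q.filter (fun s => e ∈ edgeList (P s)), edgeVar (φ s) e
        ≤ (2 * M : ℝ) * edgeLen e := by
      induction e with
      | h x y =>
        have hz : ∀ s, s ∉ (Q.filter fun s => dist (v s) x < ρ) ∪
            (Q.filter fun s => dist (v s) y < ρ) → s ∈ Q → edgeVar (φ s) s(x, y) = 0 := by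
          intro s hs hsQ
          simp only [Finset.mem_union, Finset.mem_filter, hsQ, true_and, not_or, not_lt] at hs
          rw [edgeVar_mk]
          simp [hφ, hs.1, hs.2]
        calc ∑ s ∈ Q.filter (fun s => s(x, y) ∈ edgeList (P s)), edgeVar (φ s) s(x, y)
            ≤ ∑ s ∈ Q, edgeVar (φ s) s(x, y) :=
              Finset.sum_le_sum_of_subset_of_nonneg (Finset.filter_subset _ _)
                fun s _ _ => edgeVar_nonneg _ _
          _ = ∑ s ∈ (Q.filter fun s => dist (v s) x < ρ) ∪
                (Q.filter fun s => dist (v s) y < ρ), edgeVar (φ s) s(x, y) := by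
              symm
              refine Finset.sum_subset ?_ fun s hs h => hz s h hs
              exact Finset.union_subset (Finset.filter_subset _ _) (Finset.filter_subset _ _)
          _ ≤ _ := by
              refine (Finset.sum_le_card_nsmul _ _ _ fun s _ => hlen s).trans ?_
              rw [nsmul_eq_mul]
              refine mul_le_mul_of_nonneg_right ?_ (edgeLen_nonneg _)
              have := (Finset.card_union_le (Q.filter fun s => dist (v s) x < ρ)
                (Q.filter fun s => dist (v s) y < ρ)).trans (add_le_add (hball x) (hball y))
              have h' : (((Q.filter fun s => dist (v s) x < ρ) ∪
                (Q.filter fun s => dist (v s) y < ρ)).card : ℝ) ≤ ((M + M : ℕ) : ℝ) := by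
                exact_mod_cast this
              push_cast at h'
              linarith
    have h0 := edgeLen_nonneg e
    have hl : (0 : ℝ) ≤ load P e := Nat.cast_nonneg _
    rcases le_total (load P e : ℝ) (M : ℝ) with h | h
    · rw [min_eq_left h]
      nlinarith [mul_nonneg hl h0]
    · rw [min_eq_right h]
      linarith
  calc (Q.card : ℝ) * ρ = ∑ s ∈ Q, ρ := by simp
    _ ≤ ∑ s ∈ Q, ∑ e ∈ (edgeList (P s)).toFinset, edgeVar (φ s) e := Finset.sum_le_sum h1
    _ = ∑ s ∈ Q, ∑ e ∈ (allEdges P).filter (fun e => e ∈ edgeList (P s)), edgeVar (φ s) e := by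
        refine Finset.sum_congr rfl fun s _ => Finset.sum_congr ?_ fun _ _ => rfl
        ext e
        simp only [List.mem_toFinset, Finset.mem_filter, mem_allEdges]
        exact ⟨fun h => ⟨⟨s, h⟩, h⟩, fun h => h.2⟩
    _ = ∑ e ∈ allEdges P, ∑ s ∈ Q.filter (fun s => e ∈ edgeList (P s)), edgeVar (φ s) e := by
        simp only [Finset.sum_filter]
        exact Finset.sum_comm
    _ ≤ ∑ e ∈ allEdges P, 2 * (edgeLen e * min (load P e : ℝ) (M : ℝ)) := Finset.sum_le_sum h2
    _ = _ := by rw [costf, Finset.mul_sum]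

/-- Edges in `B` are paid at the full rate `M`, the others once for each use. -/
lemma cost_le_bought_add_rented {k : ℕ} (P : Fin k → List X) (M : ℝ) (hM : 0 ≤ M)
    (B : Finset (Sym2 X)) :
    costf (fun x => min x M) P ≤ M * ∑ e ∈ B, edgeLen e
      + ∑ s, ∑ e ∈ (edgeList (P s)).toFinset \ B, edgeLen e := by
  have h1 : ∑ s, ∑ e ∈ (edgeList (P s)).toFinset \ B, edgeLen e
      = ∑ e ∈ allEdges P \ B, edgeLen e * load P e := by
    calc _ = ∑ s, ∑ e ∈ (allEdges P \ B).filter (fun e => e ∈ edgeList (P s)), edgeLen e := by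
          refine Finset.sum_congr rfl fun s _ => Finset.sum_congr ?_ fun _ _ => rfl
          ext e
          simp only [Finset.mem_sdiff, List.mem_toFinset, Finset.mem_filter, mem_allEdges]
          exact ⟨fun h => ⟨⟨⟨s, h.1⟩, h.2⟩, h.1⟩, fun h => ⟨h.2, h.1.2⟩⟩
      _ = _ := by
          simp only [Finset.sum_filter]
          rw [Finset.sum_comm]
          refine Finset.sum_congr rfl fun e _ => ?_
          rw [← Finset.sum_filter, Finset.sum_const, nsmul_eq_mul, mul_comm, load]
  rw [h1, costf, ← Finset.sum_inter_add_sum_sdiff (allEdges P) B, Finset.mul_sum]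
  refine add_le_add ?_ ?_
  · refine (Finset.sum_le_sum (g := fun e => M * edgeLen e) fun e _ => ?_).trans
      (Finset.sum_le_sum_of_subset_of_nonneg Finset.inter_subset_right
        fun e _ _ => mul_nonneg hM (edgeLen_nonneg e))
    rw [mul_comm]
    exact mul_le_mul_of_nonneg_right (min_le_right _ _) (edgeLen_nonneg e)
  · exact Finset.sum_le_sum fun e _ =>
      mul_le_mul_of_nonneg_left (min_le_left _ _) (edgeLen_nonneg e)

lemma cost_min_mono {k : ℕ} (P : Fin k → List X) {a c M : ℝ} (hc : 1 ≤ c)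
    (h : a ≤ c * M) : costf (fun x => min x a) P ≤ c * costf (fun x => min x M) P := by
  rw [costf, costf, Finset.mul_sum]
  refine Finset.sum_le_sum fun e _ => ?_
  rw [mul_left_comm]
  refine mul_le_mul_of_nonneg_left ?_ (edgeLen_nonneg e)
  have hl : (0 : ℝ) ≤ load P e := Nat.cast_nonneg _
  rcases le_total (load P e : ℝ) M with h' | h'
  · rw [min_eq_left h']
    exact (min_le_left _ _).trans (by nlinarith)
  · rw [min_eq_right h']
    exact (min_le_right _ _).trans h

/-- On `{0, …, k}`, a concave nondecreasing function vanishing at `0` is a nonnegative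
combination of the functions `min · M`. -/
lemma exists_min_decomposition (k : ℕ) (f : ℝ → ℝ) (hmono : MonotoneOn f (Set.Ici 0))
    (hconc : ConcaveOn ℝ (Set.Ici 0) f) (h0 : f 0 = 0) :
    ∃ c : ℕ → ℝ, (∀ j, 0 ≤ c j) ∧
      ∀ n : ℕ, n ≤ k → f n = ∑ j ∈ Finset.range k, c j * min (n : ℝ) ((j + 1 : ℕ) : ℝ) := by
  set δ : ℕ → ℝ := fun j => if j < k then f (j + 1) - f j else 0 with hδ
  have hδ0 : ∀ j, 0 ≤ δ j := by
    intro j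
    simp only [hδ]
    split_ifs
    · rw [sub_nonneg]
      have hj : (0 : ℝ) ≤ j := Nat.cast_nonneg j
      exact hmono (Set.mem_Ici.mpr hj) (Set.mem_Ici.mpr (by linarith)) (by linarith)
    · exact le_rfl
  refine ⟨fun j => δ j - δ (j + 1), fun j => ?_, fun n => ?_⟩
  · rw [sub_nonneg]
    by_cases hj : j + 1 < k
    · have hj0 : (0 : ℝ) ≤ j := Nat.cast_nonneg j
      have := hconc.2 (Set.mem_Ici.mpr hj0 : (j : ℝ) ∈ Set.Ici 0)
        (Set.mem_Ici.mpr (by linarith) : ((j : ℝ) + 2) ∈ Set.Ici (0 : ℝ))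
        (by norm_num : (0 : ℝ) ≤ 1 / 2) (by norm_num : (0 : ℝ) ≤ 1 / 2) (by norm_num)
      simp only [smul_eq_mul] at this
      have e : (1 / 2 * (j : ℝ) + 1 / 2 * (j + 2)) = j + 1 := by ring
      rw [e] at this
      simp only [hδ, hj, (by omega : j < k), if_true]
      push_cast
      have e2 : (j : ℝ) + 1 + 1 = j + 2 := by ring
      rw [e2]
      linarith
    · have : δ (j + 1) = 0 := by simp only [hδ, hj, if_false]
      rw [this]
      exact hδ0 j
  · induction n with
    | zero =>
      intro _
      simp only [Nat.cast_zero, h0]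
      symm
      refine Finset.sum_eq_zero fun j _ => ?_
      rw [min_eq_left (Nat.cast_nonneg _), mul_zero]
    | succ n ih =>
      intro hn
      have h1 : f ((n + 1 : ℕ) : ℝ) = f n + δ n := by
        simp only [hδ, (by omega : n < k), if_true]
        push_cast
        ring
      have h2 : ∑ j ∈ Finset.range k, ((δ j - δ (j + 1)) * min ((n + 1 : ℕ) : ℝ) ((j + 1 : ℕ) : ℝ)
          - (δ j - δ (j + 1)) * min (n : ℝ) ((j + 1 : ℕ) : ℝ)) = δ n := by
        have hk : δ k = 0 := by simp [hδ]
        calc _ = ∑ j ∈ Finset.range k, if n ≤ j then δ j - δ (j + 1) else 0 := by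
              refine Finset.sum_congr rfl fun j _ => ?_
              rw [← Nat.cast_min, ← Nat.cast_min]
              split_ifs with h
              · rw [min_eq_left (by omega), min_eq_left (by omega)]
                push_cast
                ring
              · rw [min_eq_right (by omega), min_eq_right (by omega)]
                ring
          _ = ∑ j ∈ Finset.Ico n k, (δ j - δ (j + 1)) := by
              rw [← Finset.sum_filter]
              refine Finset.sum_congr ?_ fun _ _ => rfl
              ext j
              simp only [Finset.mem_filter, Finset.mem_range, Finset.mem_Ico]
              omega
          _ = δ n := by
              have := Finset.sum_Ico_sub δ (by omega : n ≤ k)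
              rw [hk] at this
              have h3 : ∑ j ∈ Finset.Ico n k, (δ j - δ (j + 1))
                  = -∑ j ∈ Finset.Ico n k, (δ (j + 1) - δ j) := by
                rw [← Finset.sum_neg_distrib]
                exact Finset.sum_congr rfl fun _ _ => by ring
              rw [h3, this]
              ring
      rw [Finset.sum_sub_distrib] at h2
      rw [h1, ih (by omega)]
      linarith


/-- `card_mul_le_cost` for terminals indexed by natural numbers. -/
lemma card_mul_le_cost_nat {k : ℕ} {u : ℕ → X} {r : X} {P : Fin k → List X}
    (hP : ∀ s : Fin k, IsPath (u s) r (P s)) (M : ℕ) (ρ : ℝ) (hρ : 0 ≤ ρ) (Q : Finset ℕ)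
    (hk : ∀ s ∈ Q, s < k)
    (hQ : ∀ s ∈ Q, (Q.filter fun s' => dist (u s') (u s) < 2 * ρ).card ≤ M)
    (hr : ∀ s ∈ Q, ρ ≤ dist (u s) r) :
    (Q.card : ℝ) * ρ ≤ 2 * costf (fun x => min x (M : ℝ)) P := by
  set Q' : Finset (Fin k) := Finset.univ.filter fun s => (s : ℕ) ∈ Q with hQ'
  have hcard : Q'.card = Q.card := by
    rw [← Finset.card_map Fin.valEmbedding]
    congr 1
    ext n
    simp only [hQ', Finset.mem_map, Finset.mem_filter, Finset.mem_univ, true_and,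
      Fin.valEmbedding_apply]
    exact ⟨fun ⟨s, hs, h⟩ => h ▸ hs, fun h => ⟨⟨n, hk n h⟩, h, rfl⟩⟩
  rw [← hcard]
  refine card_mul_le_cost hP M ρ hρ Q' (fun s hs => ?_) fun s hs => hr s (by simpa [hQ'] using hs)
  refine le_trans ?_ (hQ s (by simpa [hQ'] using hs))
  refine Finset.card_le_card_of_injOn (fun s : Fin k => (s : ℕ)) (fun s' hs' => ?_)
    fun a _ b _ h => Fin.ext h
  simpa [hQ'] using hs'

/-- The number of terminals among `u 0, …, u n` at distance at most `8 ^ (i - 1)` from `u n`. -/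
def nearCount (u : ℕ → X) (n : ℕ) (i : ℤ) : ℕ :=
  ((Finset.range (n + 1)).filter fun j => dist (u j) (u n) ≤ (8 : ℝ) ^ (i - 1)).card

/-- The logarithmic density of terminals around `u n` at scale `i`. -/
def level (u : ℕ → X) (n : ℕ) (i : ℤ) : ℕ := Nat.log 2 (nearCount u n i)

/-- The level at scale `i`, rounded down to a square if a square was passed since scale `i - 1`. -/
def aimLevel (u : ℕ → X) (n : ℕ) (i : ℤ) : ℕ :=
  if Nat.sqrt (level u n (i - 1)) = Nat.sqrt (level u n i) then level u n i
  else Nat.sqrt (level u n i) ^ 2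

/-- The terminal `u n` is greedily chosen as a net point of scale `i` and level `a`. -/
def IsCenter (u : ℕ → X) (r : X) (i : ℤ) (a n : ℕ) : Prop :=
  2 ^ a ≤ nearCount u n i ∧ (8 : ℝ) ^ i ≤ dist (u n) r ∧
    ∀ j : Fin n, IsCenter u r i a j → (8 : ℝ) ^ i ≤ dist (u j) (u n)
termination_by n
decreasing_by exact j.2

/-- The indices of the net points that are candidates for a target. -/
def targetSet (u : ℕ → X) (r : X) (n : ℕ) (p : X) (i : ℤ) (a : ℕ) : Set ℕ :=
  {j | j ≤ n ∧ IsCenter u r i a j ∧ dist p (u j) ≤ 10 * (8 : ℝ) ^ (i - 1)}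

/-- The first net point of scale `i` and level `a` near `p`. -/
def target (u : ℕ → X) (r : X) (n : ℕ) (p : X) (i : ℤ) (a : ℕ) : X :=
  u (sInf (targetSet u r n p i a))

/-- The lowest scale on the route of `u n`. -/
def bottomScale (u : ℕ → X) (r : X) (n : ℕ) : ℤ := Int.log 8 (dist (u n) r) - (n + 1)

/-- The points of the route of `u n`, up to the net point at the highest scale. -/
def hop (u : ℕ → X) (r : X) (n : ℕ) : ℕ → X
  | 0 => u n
  | s + 1 => target u r n (hop u r n s) (bottomScale u r n + s + 1)
      (aimLevel u n (bottomScale u r n + s + 1))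

/-- The points of the route of `u n`. -/
def waypoint (u : ℕ → X) (r : X) (n s : ℕ) : X := if s ≤ n + 1 then hop u r n s else r

/-- The route of the terminal `u n`. -/
def route (u : ℕ → X) (r : X) (n : ℕ) : List X :=
  if u n = r then [r] else (List.range (n + 3)).map (waypoint u r n)

lemma isPath_route (u : ℕ → X) (r : X) (n : ℕ) : IsPath (u n) r (route u r n) := by
  unfold route
  split_ifs with h
  · simp [IsPath, h]
  · constructor
    · simp [List.range_succ_eq_map, waypoint, hop]
    · simp [List.range_succ, waypoint]

section Congr

variable {u u' : ℕ → X} {r : X} {n : ℕ}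

lemma nearCount_congr (h : ∀ j ≤ n, u j = u' j) (i : ℤ) : nearCount u n i = nearCount u' n i := by
  unfold nearCount
  congr 1
  refine Finset.filter_congr fun j hj => ?_
  rw [h j (by simpa [Nat.lt_succ_iff] using hj), h n le_rfl]

lemma isCenter_congr (i : ℤ) (a : ℕ) (n : ℕ) :
    (∀ j ≤ n, u j = u' j) → (IsCenter u r i a n ↔ IsCenter u' r i a n) := by
  induction n using Nat.strong_induction_on with
  | _ n ih =>
    intro h
    rw [IsCenter, IsCenter, nearCount_congr h, h n le_rfl]
    refine and_congr Iff.rfl (and_congr Iff.rfl (forall_congr' fun j => ?_))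
    rw [ih j j.2 fun l hl => h l (hl.trans j.2.le), h j j.2.le]

lemma target_congr (h : ∀ j ≤ n, u j = u' j) (p : X) (i : ℤ) (a : ℕ) :
    target u r n p i a = target u' r n p i a := by
  have hset : targetSet u r n p i a = targetSet u' r n p i a := by
    ext j
    refine and_congr_right fun hj => ?_
    rw [isCenter_congr i a j fun l hl => h l (hl.trans hj), h j hj]
  unfold target
  rw [hset]
  refine h _ ?_
  rcases Set.eq_empty_or_nonempty (targetSet u' r n p i a) with h0 | h0
  · simp [h0]
  · exact (Nat.sInf_mem h0).1

lemma aimLevel_congr (h : ∀ j ≤ n, u j = u' j) (i : ℤ) : aimLevel u n i = aimLevel u' n i := by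
  unfold aimLevel level
  rw [nearCount_congr h, nearCount_congr h]

lemma hop_congr (h : ∀ j ≤ n, u j = u' j) (s : ℕ) : hop u r n s = hop u' r n s := by
  induction s with
  | zero => exact h n le_rfl
  | succ s ih => rw [hop, hop, ih, target_congr h, aimLevel_congr h, bottomScale, bottomScale,
      h n le_rfl]

lemma route_congr (h : ∀ j ≤ n, u j = u' j) : route u r n = route u' r n := by
  have : waypoint u r n = waypoint u' r n := by
    funext s
    simp only [waypoint, hop_congr h]
  simp only [route, this, h n le_rfl]

end Congr

section Levels

variable (u : ℕ → X) (r : X) (n : ℕ)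

lemma nearCount_pos (i : ℤ) : 1 ≤ nearCount u n i := by
  refine Finset.card_pos.mpr ⟨n, ?_⟩
  simp only [Finset.mem_filter, Finset.mem_range, dist_self]
  exact ⟨by omega, by positivity⟩

lemma nearCount_le (i : ℤ) : nearCount u n i ≤ n + 1 :=
  (Finset.card_filter_le _ _).trans (by simp)

lemma nearCount_mono {i i' : ℤ} (h : i ≤ i') : nearCount u n i ≤ nearCount u n i' := by
  refine Finset.card_le_card (Finset.monotone_filter_right _ fun j _ hj => le_trans hj ?_)
  exact zpow_le_zpow_right₀ (by norm_num) (by omega)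

lemma level_mono {i i' : ℤ} (h : i ≤ i') : level u n i ≤ level u n i' :=
  Nat.log_mono_right (nearCount_mono u n h)

lemma level_le (i : ℤ) : level u n i ≤ Nat.log 2 (n + 1) :=
  Nat.log_mono_right (nearCount_le u n i)

lemma two_pow_level_le (i : ℤ) : 2 ^ level u n i ≤ nearCount u n i :=
  Nat.pow_log_le_self 2 (by have := nearCount_pos u n i; omega)

lemma aimLevel_le (i : ℤ) : aimLevel u n i ≤ level u n i := by
  unfold aimLevel
  split_ifs
  · exact le_rfl
  · exact Nat.sqrt_le' _

lemma sqrt_aimLevel (i : ℤ) : Nat.sqrt (aimLevel u n i) = Nat.sqrt (level u n i) := by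
  unfold aimLevel
  split_ifs
  · rfl
  · exact Nat.sqrt_eq' _

lemma level_pred_le_aimLevel (i : ℤ) : level u n (i - 1) ≤ aimLevel u n i := by
  have hm : level u n (i - 1) ≤ level u n i := level_mono u n (by omega)
  unfold aimLevel
  split_ifs with h
  · exact hm
  · have h1 : Nat.sqrt (level u n (i - 1)) + 1 ≤ Nat.sqrt (level u n i) :=
      lt_of_le_of_ne (Nat.sqrt_le_sqrt hm) h
    have h2 := Nat.lt_succ_sqrt' (level u n (i - 1))
    exact h2.le.trans (Nat.pow_le_pow_left h1 2)

/-- The levels that may follow level `a`. -/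
def nextLevels (L a : ℕ) : Finset ℕ :=
  ((Finset.range (L + 1)).filter fun b => Nat.sqrt b = Nat.sqrt a) ∪
    (Finset.range (Nat.sqrt L + 1)).image fun b => b ^ 2

lemma aimLevel_mem_nextLevels {L : ℕ} (hL : Nat.log 2 (n + 1) ≤ L) (i : ℤ) :
    aimLevel u n (i + 1) ∈ nextLevels L (aimLevel u n i) := by
  have h0 : level u n (i + 1) ≤ L := (level_le u n _).trans hL
  rw [nextLevels, sqrt_aimLevel, aimLevel, add_sub_cancel_right, Finset.mem_union]
  split_ifs with h
  · left
    rw [Finset.mem_filter, Finset.mem_range]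
    exact ⟨by omega, h.symm⟩
  · right
    exact Finset.mem_image_of_mem _ (Finset.mem_range.mpr (Nat.lt_succ_of_le (Nat.sqrt_le_sqrt h0)))

lemma card_nextLevels_le {L a : ℕ} (ha : a ≤ L) : (nextLevels L a).card ≤ 3 * Nat.sqrt L + 2 := by
  have h1 : ((Finset.range (L + 1)).filter fun b => Nat.sqrt b = Nat.sqrt a).card
      ≤ 2 * Nat.sqrt a + 1 := by
    calc _ ≤ (Finset.Ico (Nat.sqrt a ^ 2) ((Nat.sqrt a + 1) ^ 2)).card := by
          refine Finset.card_le_card fun b hb => ?_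
          rw [Finset.mem_filter] at hb
          rw [Finset.mem_Ico, ← hb.2]
          exact ⟨Nat.sqrt_le' b, Nat.lt_succ_sqrt' b⟩
      _ = 2 * Nat.sqrt a + 1 := by
          rw [Nat.card_Ico, add_sq, mul_one, one_pow]
          omega
  have h2 : ((Finset.range (Nat.sqrt L + 1)).image fun b => b ^ 2).card ≤ Nat.sqrt L + 1 :=
    Finset.card_image_le.trans (by simp)
  have h3 := Nat.sqrt_le_sqrt ha
  exact (Finset.card_union_le _ _).trans (by omega)

end Levels

section Route

variable {u : ℕ → X} {r : X} {n : ℕ}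

lemma exists_isCenter {i : ℤ} {a : ℕ} (ha : a ≤ level u n i) (hi : (8 : ℝ) ^ i ≤ dist (u n) r) :
    ∃ j ≤ n, IsCenter u r i a j ∧ dist (u j) (u n) < (8 : ℝ) ^ i := by
  by_cases h : IsCenter u r i a n
  · exact ⟨n, le_rfl, h, by rw [dist_self]; positivity⟩
  · rw [IsCenter] at h
    have h1 : 2 ^ a ≤ nearCount u n i :=
      (Nat.pow_le_pow_right (by norm_num) ha).trans (two_pow_level_le u n i)
    by_contra hcon
    push Not at hcon
    exact h ⟨h1, hi, fun j hj => hcon j j.2.le hj⟩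

lemma target_eq_of_le {N : ℕ} (hN : n ≤ N) {p : X} {i : ℤ} {a : ℕ}
    (h : (targetSet u r n p i a).Nonempty) : target u r n p i a = target u r N p i a := by
  unfold target
  congr 1
  have hsub : targetSet u r n p i a ⊆ targetSet u r N p i a :=
    fun j hj => ⟨hj.1.trans hN, hj.2⟩
  refine le_antisymm (Nat.sInf_le ?_) (Nat.sInf_le (hsub (Nat.sInf_mem h)))
  have h1 := Nat.sInf_mem (h.mono hsub)
  have h2 := Nat.sInf_le (hsub (Nat.sInf_mem h))
  exact ⟨h2.trans (Nat.sInf_mem h).1, h1.2⟩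

lemma bottomScale_zpow_le (hr : u n ≠ r) {s : ℕ} (hs : s ≤ n) :
    (8 : ℝ) ^ (bottomScale u r n + s + 1) ≤ dist (u n) r := by
  refine le_trans ?_ (Int.zpow_log_le_self (b := 8) (by norm_num) (dist_pos.mpr hr))
  push_cast
  refine zpow_le_zpow_right₀ (by norm_num) ?_
  rw [bottomScale]
  omega

lemma targetSet_nonempty (hr : u n ≠ r) {s : ℕ} (hs : s ≤ n)
    (hd : dist (hop u r n s) (u n) ≤ 2 * (8 : ℝ) ^ (bottomScale u r n + s)) :
    (targetSet u r n (hop u r n s) (bottomScale u r n + s + 1)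
      (aimLevel u n (bottomScale u r n + s + 1))).Nonempty := by
  obtain ⟨j, hj, hc, hj'⟩ := exists_isCenter (aimLevel_le u n (bottomScale u r n + s + 1))
    (bottomScale_zpow_le hr hs)
  refine ⟨j, hj, hc, ?_⟩
  have h1 := dist_triangle_right (hop u r n s) (u j) (u n)
  rw [add_sub_cancel_right]
  rw [zpow_add_one₀ (by norm_num)] at hj'
  linarith

lemma dist_hop_le (hr : u n ≠ r) (s : ℕ) (hs : s ≤ n + 1) :
    dist (hop u r n s) (u n) ≤ 2 * (8 : ℝ) ^ (bottomScale u r n + s) := by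
  induction s with
  | zero =>
    rw [hop, dist_self]
    positivity
  | succ s ih =>
    have hd := ih (by omega)
    have h1 := (Nat.sInf_mem (targetSet_nonempty hr (by omega) hd)).2.2
    have h2 := dist_triangle_left (hop u r n (s + 1)) (u n) (hop u r n s)
    rw [add_sub_cancel_right] at h1
    have h3 : dist (hop u r n s) (hop u r n (s + 1)) ≤ 10 * (8 : ℝ) ^ (bottomScale u r n + s) := h1
    push_cast
    rw [← add_assoc, zpow_add_one₀ (by norm_num)]
    have : (0 : ℝ) < (8 : ℝ) ^ (bottomScale u r n + s) := by positivity
    linarith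

lemma dist_hop_succ_le (hr : u n ≠ r) {s : ℕ} (hs : s ≤ n) :
    dist (hop u r n s) (hop u r n (s + 1)) ≤ 10 * (8 : ℝ) ^ (bottomScale u r n + s) := by
  have h1 := (Nat.sInf_mem (targetSet_nonempty hr hs (dist_hop_le hr s (by omega)))).2.2
  rw [add_sub_cancel_right] at h1
  exact h1

lemma hop_succ_eq (hr : u n ≠ r) {s : ℕ} (hs : s ≤ n) {N : ℕ} (hN : n ≤ N) :
    hop u r n (s + 1) = target u r N (hop u r n s) (bottomScale u r n + s + 1)
      (aimLevel u n (bottomScale u r n + s + 1)) :=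
  target_eq_of_le hN (targetSet_nonempty hr hs (dist_hop_le hr s (by omega)))

lemma exists_hop_succ_eq (hr : u n ≠ r) {s : ℕ} (hs : s ≤ n) :
    ∃ j ≤ n, hop u r n (s + 1) = u j ∧ IsCenter u r (bottomScale u r n + s + 1)
      (aimLevel u n (bottomScale u r n + s + 1)) j := by
  have h1 := Nat.sInf_mem (targetSet_nonempty hr hs (dist_hop_le hr s (by omega)))
  exact ⟨_, h1.1, rfl, h1.2.1⟩

lemma dist_waypoint_le (hr : u n ≠ r) {s : ℕ} (hs : s ≤ n + 1) :
    dist (waypoint u r n s) (waypoint u r n (s + 1))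
      ≤ 10 * (8 : ℝ) ^ (bottomScale u r n + s) := by
  rcases hs.lt_or_eq with h | rfl
  · rw [waypoint, waypoint, if_pos hs, if_pos (by omega)]
    exact dist_hop_succ_le hr (by omega)
  · rw [waypoint, waypoint, if_pos hs, if_neg (by omega)]
    have h1 := dist_hop_le hr (n + 1) le_rfl
    have h2 := Int.lt_zpow_succ_log_self (b := 8) (by norm_num) (dist (u n) r)
    have h3 := dist_triangle (hop u r n (n + 1)) (u n) r
    have h4 : bottomScale u r n + ((n + 1 : ℕ) : ℤ) = Int.log 8 (dist (u n) r) := by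
      rw [bottomScale]
      push_cast
      ring
    rw [h4] at h1 ⊢
    push_cast at h2
    rw [zpow_add_one₀ (by norm_num)] at h2
    linarith

/-- The edges of a path given by a sequence of points. -/
lemma mem_edgeList_map_range {w : ℕ → X} {N : ℕ} {e : Sym2 X}
    (h : e ∈ edgeList ((List.range (N + 1)).map w)) : ∃ s < N, e = s(w s, w (s + 1)) := by
  induction N generalizing w with
  | zero => simp [edgeList] at h
  | succ N ih =>
    rw [List.range_succ_eq_map, List.map_cons, List.map_map] at h
    have h2 := h
    rw [List.range_succ_eq_map, List.map_cons, edgeList_cons_cons, List.mem_cons] at h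
    rcases h with h | h
    · exact ⟨0, by omega, h⟩
    · rw [← List.map_cons, ← List.range_succ_eq_map] at h
      obtain ⟨s, hs, h⟩ := ih h
      exact ⟨s + 1, by omega, h⟩

/-- The edges of a route outside `B` have total length at most that of the steps outside `B`. -/
lemma sum_edgeLen_route_le (hr : u n ≠ r) (B : Finset (Sym2 X)) :
    ∑ e ∈ (edgeList (route u r n)).toFinset \ B, edgeLen e
      ≤ ∑ s ∈ (Finset.range (n + 2)).filter
          (fun s => s(waypoint u r n s, waypoint u r n (s + 1)) ∉ B),
        10 * (8 : ℝ) ^ (bottomScale u r n + s) := by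
  set S := (Finset.range (n + 2)).filter
          (fun s => s(waypoint u r n s, waypoint u r n (s + 1)) ∉ B) with hS
  calc _ ≤ ∑ e ∈ S.image fun s => s(waypoint u r n s, waypoint u r n (s + 1)), edgeLen e := by
        refine Finset.sum_le_sum_of_subset_of_nonneg (fun e he => ?_) fun e _ _ => edgeLen_nonneg e
        rw [Finset.mem_sdiff, List.mem_toFinset, route, if_neg hr] at he
        obtain ⟨s, hs, rfl⟩ := mem_edgeList_map_range he.1
        exact Finset.mem_image.mpr ⟨s, by simpa [hS, hs] using he.2, rfl⟩
    _ ≤ ∑ s ∈ S, edgeLen s(waypoint u r n s, waypoint u r n (s + 1)) :=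
        Finset.sum_image_le_of_nonneg fun _ _ => edgeLen_nonneg _
    _ ≤ _ := by
        refine Finset.sum_le_sum fun s hs => ?_
        rw [hS, Finset.mem_filter, Finset.mem_range] at hs
        exact dist_waypoint_le hr (by omega)

end Route

section Bounds

variable {k : ℕ} {u : ℕ → X} {r : X} {P : Fin k → List X}

lemma IsCenter.eq_of_dist_lt {i : ℤ} {a j j' : ℕ} (hj : IsCenter u r i a j)
    (hj' : IsCenter u r i a j') (h : dist (u j) (u j') < (8 : ℝ) ^ i) : j = j' := by
  have h1 := hj
  have h2 := hj'
  rw [IsCenter] at h1 h2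
  rcases lt_trichotomy j j' with hlt | heq | hlt
  · exact absurd (h2.2.2 ⟨j, hlt⟩ hj) (not_le.mpr h)
  · exact heq
  · refine absurd (h1.2.2 ⟨j', hlt⟩ hj') (not_le.mpr ?_)
    rwa [dist_comm]

lemma card_isCenter_mul_le (hP : ∀ s : Fin k, IsPath (u s) r (P s)) {M m a : ℕ} (hm : 2 ^ m ≤ M)
    (ha : m ≤ a) (i : ℤ) :
    (((Finset.range k).filter (IsCenter u r i a)).card : ℝ) * (2 ^ m * (8 : ℝ) ^ i)
      ≤ 8 * costf (fun x => min x (M : ℝ)) P := by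
  set N := (Finset.range k).filter (IsCenter u r i a) with hN
  have hNc : ∀ j ∈ N, IsCenter u r i a j := fun j hj => (Finset.mem_filter.mp hj).2
  have hex : ∀ j : ℕ, ∃ t : Finset ℕ, j ∈ N →
      t ⊆ (Finset.range (j + 1)).filter (fun l => dist (u l) (u j) ≤ (8 : ℝ) ^ (i - 1)) ∧
      t.card = 2 ^ a := by
    intro j
    by_cases hj : j ∈ N
    · have h1 := hNc j hj
      rw [IsCenter] at h1
      obtain ⟨t, ht, ht'⟩ := Finset.exists_subset_card_eq h1.1
      exact ⟨t, fun _ => ⟨ht, ht'⟩⟩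
    · exact ⟨∅, fun h => absurd h hj⟩
  choose T hT using hex
  have hpos : (0 : ℝ) < (8 : ℝ) ^ i := by positivity
  have h8 : (8 : ℝ) ^ (i - 1) = (8 : ℝ) ^ i / 8 := zpow_sub_one₀ (by norm_num) i
  have hmem : ∀ j ∈ N, ∀ l ∈ T j, l ≤ j ∧ dist (u l) (u j) ≤ (8 : ℝ) ^ i / 8 := by
    intro j hj l hl
    have := (hT j hj).1 hl
    rw [Finset.mem_filter, Finset.mem_range, h8] at this
    exact ⟨by omega, this.2⟩
  have hsep : ∀ j ∈ N, ∀ j' ∈ N, ∀ l ∈ T j, ∀ l' ∈ T j', dist (u l) (u l') < (8 : ℝ) ^ i / 2 →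
      j = j' := by
    intro j hj j' hj' l hl l' hl' hd
    refine (hNc j hj).eq_of_dist_lt (hNc j' hj') ?_
    have h1 := (hmem j hj l hl).2
    have h2 := (hmem j' hj' l' hl').2
    have h3 := dist_triangle4 (u j) (u l) (u l') (u j')
    rw [dist_comm] at h1
    linarith
  have hcard : (N.biUnion T).card = N.card * 2 ^ a := by
    rw [Finset.card_biUnion]
    · rw [Finset.sum_congr rfl fun j hj => (hT j hj).2]
      simp
    · intro j hj j' hj' hne
      refine Finset.disjoint_left.mpr fun l hl hl' => ?_
      exact hne (hsep j hj j' hj' l hl l hl' (by rw [dist_self]; positivity))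
  have h1 := card_mul_le_cost_nat hP (2 ^ a) ((8 : ℝ) ^ i / 4) (by positivity) (N.biUnion T)
    (fun l hl => by
      obtain ⟨j, hj, hl⟩ := Finset.mem_biUnion.mp hl
      have h1 := (hmem j hj l hl).1
      have h2 := Finset.mem_range.mp (Finset.mem_filter.mp hj).1
      omega)
    (fun l hl => by
      obtain ⟨j, hj, hl⟩ := Finset.mem_biUnion.mp hl
      rw [← (hT j hj).2]
      refine Finset.card_le_card fun l' hl' => ?_
      rw [Finset.mem_filter, Finset.mem_biUnion] at hl'
      obtain ⟨⟨j', hj', hl''⟩, hd⟩ := hl'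
      rw [← hsep j' hj' j hj l' hl'' l hl (by linarith)]
      exact hl'')
    (fun l hl => by
      obtain ⟨j, hj, hl⟩ := Finset.mem_biUnion.mp hl
      have h1 := (hmem j hj l hl).2
      have h2 := hNc j hj
      rw [IsCenter] at h2
      have h3 := dist_triangle_left (u j) r (u l)
      linarith [h2.2.1])
  have h2 : costf (fun x => min x ((2 ^ a : ℕ) : ℝ)) P
      ≤ 2 ^ (a - m) * costf (fun x => min x (M : ℝ)) P := by
    refine cost_min_mono P (one_le_pow₀ (by norm_num)) ?_
    have : 2 ^ a ≤ 2 ^ (a - m) * M := by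
      calc 2 ^ a = 2 ^ (a - m) * 2 ^ m := by rw [← pow_add]; congr 1; omega
        _ ≤ _ := Nat.mul_le_mul_left _ hm
    exact_mod_cast this
  rw [hcard] at h1
  have h3 : (2 : ℝ) ^ a = 2 ^ (a - m) * 2 ^ m := by rw [← pow_add]; congr 1; omega
  push_cast at h1
  push_cast at h2
  rw [h3] at h1 h2
  have hp : (0 : ℝ) < 2 ^ (a - m) := by positivity
  refine le_of_mul_le_mul_left ?_ hp
  linarith

/-- Terminals with few terminals around them contribute little. -/
lemma card_sparse_mul_le (hP : ∀ s : Fin k, IsPath (u s) r (P s)) {M : ℕ} (i : ℤ) :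
    (((Finset.range k).filter fun n => nearCount u n (i - 1) ≤ M ∧
      (8 : ℝ) ^ i ≤ dist (u n) r).card : ℝ) * (8 : ℝ) ^ i
      ≤ 512 * costf (fun x => min x (M : ℝ)) P := by
  set F := (Finset.range k).filter fun n => nearCount u n (i - 1) ≤ M ∧
      (8 : ℝ) ^ i ≤ dist (u n) r with hF
  have hpos : (0 : ℝ) < (8 : ℝ) ^ i := by positivity
  have h8 : (8 : ℝ) ^ (i - 1 - 1) = (8 : ℝ) ^ i / 64 := by
    rw [zpow_sub_one₀ (by norm_num), zpow_sub_one₀ (by norm_num)]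
    ring
  have h1 := card_mul_le_cost_nat hP M ((8 : ℝ) ^ i / 256) (by positivity) F
    (fun l hl => Finset.mem_range.mp (Finset.mem_filter.mp hl).1)
    (fun l hl => by
      set G := F.filter fun l' => dist (u l') (u l) < 2 * ((8 : ℝ) ^ i / 256) with hG
      have hne : G.Nonempty := ⟨l, by
        rw [hG, Finset.mem_filter, dist_self]
        exact ⟨hl, by positivity⟩⟩
      obtain ⟨hmF, hmd⟩ := Finset.mem_filter.mp (Finset.max'_mem G hne)
      refine le_trans (Finset.card_le_card fun l' hl' => ?_) (Finset.mem_filter.mp hmF).2.1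
      rw [Finset.mem_filter, Finset.mem_range, h8]
      refine ⟨Nat.lt_succ_of_le (Finset.le_max' G l' hl'), ?_⟩
      have h2 := (Finset.mem_filter.mp hl').2
      have h3 := dist_triangle_right (u l') (u (G.max' hne)) (u l)
      linarith)
    (fun l hl => by
      have := (Finset.mem_filter.mp hl).2.2
      linarith)
  linarith

lemma dist_le_cost (hP : ∀ s : Fin k, IsPath (u s) r (P s)) {M : ℕ} (hM : 1 ≤ M) {n : ℕ}
    (hn : n < k) : dist (u n) r ≤ 2 * costf (fun x => min x (M : ℝ)) P := by
  have h1 := card_mul_le_cost_nat hP M (dist (u n) r) dist_nonneg {n} (by simpa using hn)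
    (fun l hl => (Finset.card_filter_le _ _).trans (by simpa using hM))
    (fun l hl => by rw [Finset.mem_singleton.mp hl])
  simpa using h1

lemma sum_biUnion_le {ι α : Type*} [DecidableEq α] (s : Finset ι) (t : ι → Finset α) {f : α → ℝ}
    (hf : ∀ x, 0 ≤ f x) : ∑ x ∈ s.biUnion t, f x ≤ ∑ i ∈ s, ∑ x ∈ t i, f x := by
  induction s using Finset.induction_on with
  | empty => simp
  | insert a s ha ih =>
    rw [Finset.biUnion_insert, Finset.sum_insert ha]
    have := Finset.sum_union_inter (s₁ := t a) (s₂ := s.biUnion t) (f := f)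
    have h0 : 0 ≤ ∑ x ∈ t a ∩ s.biUnion t, f x := Finset.sum_nonneg fun x _ => hf x
    linarith

/-- The edges leaving the net point `u j` of scale `i` and level `a`. -/
def outEdges (u : ℕ → X) (r : X) (k L : ℕ) (i : ℤ) (a j : ℕ) : Finset (Sym2 X) :=
  ((insert r ((nextLevels L a).image fun b => target u r (k - 1) (u j) (i + 1) b)).filter
    fun y => dist (u j) y ≤ 10 * (8 : ℝ) ^ i).image fun y => s(u j, y)

lemma sum_outEdges_le {L a : ℕ} (ha : a ≤ L) (i : ℤ) (j : ℕ) :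
    ∑ e ∈ outEdges u r k L i a j, edgeLen e ≤ (3 * Nat.sqrt L + 3) * (10 * (8 : ℝ) ^ i) := by
  refine (Finset.sum_image_le_of_nonneg fun _ _ => edgeLen_nonneg _).trans ?_
  refine (Finset.sum_le_card_nsmul _ _ (10 * (8 : ℝ) ^ i)
    fun y hy => (Finset.mem_filter.mp hy).2).trans ?_
  rw [nsmul_eq_mul]
  refine mul_le_mul_of_nonneg_right ?_ (by positivity)
  have h1 := (Finset.card_filter_le (insert r
    ((nextLevels L a).image fun b => target u r (k - 1) (u j) (i + 1) b))
    fun y => dist (u j) y ≤ 10 * (8 : ℝ) ^ i).trans ((Finset.card_insert_le _ _).trans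
      (Nat.add_le_add_right (Finset.card_image_le.trans (card_nextLevels_le ha)) 1))
  exact_mod_cast h1

/-- The edges bought at the full rate: those leaving net points of level at least `m`. -/
def boughtEdges (u : ℕ → X) (r : X) (k L m : ℕ) (I : Finset ℤ) : Finset (Sym2 X) :=
  I.biUnion fun i => (Finset.Icc m L).biUnion fun a =>
    ((Finset.range k).filter (IsCenter u r i a)).biUnion fun j => outEdges u r k L i a j

lemma sum_boughtEdges_le (hP : ∀ s : Fin k, IsPath (u s) r (P s)) {M m L : ℕ} (hm : 2 ^ m ≤ M)
    (hM : M ≤ 2 ^ (m + 1)) (I : Finset ℤ) :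
    M * ∑ e ∈ boughtEdges u r k L m I, edgeLen e
      ≤ 480 * I.card * (L + 1) * (Nat.sqrt L + 1) * costf (fun x => min x (M : ℝ)) P := by
  set K := costf (fun x => min x (M : ℝ)) P with hK
  have hK0 : 0 ≤ K := by
    have := card_isCenter_mul_le hP hm le_rfl 0
    have h2 : (0 : ℝ) ≤ (((Finset.range k).filter (IsCenter u r 0 m)).card : ℝ)
      * (2 ^ m * (8 : ℝ) ^ (0 : ℤ)) := by positivity
    linarith
  have hp : (0 : ℝ) ≤ 2 ^ (m + 1) := by positivity
  have h1 : ∀ i, ∀ a ∈ Finset.Icc m L, (2 ^ (m + 1) : ℝ) *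
      ∑ e ∈ ((Finset.range k).filter (IsCenter u r i a)).biUnion
        (fun j => outEdges u r k L i a j), edgeLen e ≤ 480 * (Nat.sqrt L + 1) * K := by
    intro i a ha
    rw [Finset.mem_Icc] at ha
    have h2 := (sum_biUnion_le ((Finset.range k).filter (IsCenter u r i a))
      (fun j => outEdges u r k L i a j) edgeLen_nonneg).trans
      (Finset.sum_le_card_nsmul _ _ _ fun j _ => sum_outEdges_le ha.2 i j)
    rw [nsmul_eq_mul] at h2
    have h3 := card_isCenter_mul_le hP hm ha.1 i
    calc _ ≤ _ := mul_le_mul_of_nonneg_left h2 hp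
      _ = (60 * (Nat.sqrt L + 1)) * ((((Finset.range k).filter (IsCenter u r i a)).card : ℝ)
            * (2 ^ m * (8 : ℝ) ^ i)) := by ring
      _ ≤ (60 * (Nat.sqrt L + 1)) * (8 * K) := mul_le_mul_of_nonneg_left h3 (by positivity)
      _ = _ := by ring
  have h2 : ∀ i, (2 ^ (m + 1) : ℝ) * ∑ e ∈ (Finset.Icc m L).biUnion (fun a =>
      ((Finset.range k).filter (IsCenter u r i a)).biUnion
        fun j => outEdges u r k L i a j), edgeLen e ≤ (L + 1) * (480 * (Nat.sqrt L + 1) * K) := by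
    intro i
    refine (mul_le_mul_of_nonneg_left (sum_biUnion_le _ _ edgeLen_nonneg)
      hp).trans ?_
    rw [Finset.mul_sum]
    refine (Finset.sum_le_card_nsmul _ _ _ (h1 i)).trans ?_
    rw [nsmul_eq_mul, Nat.card_Icc]
    refine mul_le_mul_of_nonneg_right ?_ (by positivity)
    exact_mod_cast Nat.sub_le _ _
  have hMr : (M : ℝ) ≤ 2 ^ (m + 1) := by exact_mod_cast hM
  calc M * ∑ e ∈ boughtEdges u r k L m I, edgeLen e
      ≤ 2 ^ (m + 1) * ∑ e ∈ boughtEdges u r k L m I, edgeLen e :=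
        mul_le_mul_of_nonneg_right hMr (Finset.sum_nonneg fun e _ => edgeLen_nonneg e)
    _ ≤ ∑ i ∈ I, 2 ^ (m + 1) * ∑ e ∈ (Finset.Icc m L).biUnion (fun a =>
          ((Finset.range k).filter (IsCenter u r i a)).biUnion
            fun j => outEdges u r k L i a j), edgeLen e := by
        rw [← Finset.mul_sum]
        exact mul_le_mul_of_nonneg_left (sum_biUnion_le _ _ edgeLen_nonneg) hp
    _ ≤ I.card • ((L + 1) * (480 * (Nat.sqrt L + 1) * K)) :=
        Finset.sum_le_card_nsmul _ _ _ fun i _ => h2 i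
    _ = _ := by
        rw [nsmul_eq_mul]
        ring

end Bounds

section Rent

variable {k : ℕ} {u : ℕ → X} {r : X} {P : Fin k → List X}

lemma mem_boughtEdges {n : ℕ} (hn : n < k) (hr : u n ≠ r) {s : ℕ} (hs : s ≤ n) {m : ℕ}
    {I : Finset ℤ} (hI : bottomScale u r n + s + 1 ∈ I)
    (hm : m ≤ aimLevel u n (bottomScale u r n + s + 1)) :
    s(waypoint u r n (s + 1), waypoint u r n (s + 1 + 1)) ∈
      boughtEdges u r k (Nat.log 2 k) m I := by
  set i := bottomScale u r n + s + 1 with hi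
  have hL : Nat.log 2 (n + 1) ≤ Nat.log 2 k := Nat.log_mono_right hn
  have hlen := dist_waypoint_le hr (s := s + 1) (by omega)
  have hcast : bottomScale u r n + ((s + 1 : ℕ) : ℤ) = i := by
    push_cast
    rw [hi, add_assoc]
  rw [hcast] at hlen
  have hw : waypoint u r n (s + 1) = hop u r n (s + 1) := if_pos (by omega)
  obtain ⟨j, hj, hju, hjc⟩ := exists_hop_succ_eq hr hs
  rw [hw, hju] at hlen ⊢
  simp only [boughtEdges, Finset.mem_biUnion]
  refine ⟨i, hI, aimLevel u n i, Finset.mem_Icc.mpr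
    ⟨hm, (aimLevel_le u n i).trans ((level_le u n i).trans hL)⟩, j,
    Finset.mem_filter.mpr ⟨Finset.mem_range.mpr (by omega), hjc⟩, ?_⟩
  refine Finset.mem_image_of_mem _ (Finset.mem_filter.mpr ⟨?_, hlen⟩)
  rw [Finset.mem_insert]
  rcases hs.lt_or_eq with h | rfl
  · right
    refine Finset.mem_image.mpr
      ⟨aimLevel u n (i + 1), aimLevel_mem_nextLevels u n hL i, ?_⟩
    have hw2 : waypoint u r n (s + 1 + 1) = hop u r n (s + 1 + 1) := if_pos (by omega)
    have h2 := hop_succ_eq hr (s := s + 1) (by omega) (N := k - 1) (by omega)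
    rw [hcast, hju] at h2
    rw [hw2, h2]
  · left
    exact if_neg (by omega)

lemma sum_zpow_lt_le (e c : ℤ) (N : ℕ) :
    ∑ s ∈ (Finset.range N).filter (fun s : ℕ => e + s < c), (8 : ℝ) ^ (e + s)
      ≤ (8 : ℝ) ^ c / 7 := by
  suffices h : ∑ s ∈ (Finset.range N).filter (fun s : ℕ => e + s < c), (8 : ℝ) ^ (e + s)
      ≤ (8 : ℝ) ^ min (e + N) c / 7 by
    refine h.trans (div_le_div_of_nonneg_right ?_ (by norm_num))
    exact zpow_le_zpow_right₀ (by norm_num) (min_le_right _ _)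
  induction N with
  | zero =>
    simp only [Finset.range_zero, Finset.filter_empty, Finset.sum_empty]
    positivity
  | succ N ih =>
    rw [Finset.sum_filter, Finset.sum_range_succ, ← Finset.sum_filter]
    by_cases h : e + N < c
    · rw [min_eq_left h.le] at ih
      rw [if_pos h, min_eq_left (by push_cast; omega)]
      push_cast
      rw [← add_assoc, zpow_add_one₀ (by norm_num)]
      linarith
    · rw [min_eq_right (by omega)] at ih
      rw [if_neg h, min_eq_right (by push_cast; omega)]
      linarith

/-- The cost of the steps of one route that are not bought. -/
lemma rent_le {n : ℕ} (hn : n < k) (hr : u n ≠ r) {m M : ℕ} (hm : 2 ^ m ≤ M) {c t : ℤ}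
    (ht : Int.log 8 (dist (u n) r) ≤ t) :
    ∑ e ∈ (edgeList (route u r n)).toFinset \
        boughtEdges u r k (Nat.log 2 k) m (Finset.Icc c t), edgeLen e
      ≤ 10 * (dist (u n) r * (1 / 8) ^ (n + 1)) + 2 * (8 : ℝ) ^ c
        + ∑ i ∈ (Finset.Icc c t).filter (fun i => nearCount u n (i - 1) ≤ M ∧
            (8 : ℝ) ^ i ≤ dist (u n) r), 10 * (8 : ℝ) ^ i := by
  set e := bottomScale u r n with he
  set B := boughtEdges u r k (Nat.log 2 k) m (Finset.Icc c t) with hB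
  set J := (Finset.Icc c t).filter (fun i => nearCount u n (i - 1) ≤ M ∧
            (8 : ℝ) ^ i ≤ dist (u n) r) with hJ
  refine (sum_edgeLen_route_le hr B).trans ?_
  have hsub : (Finset.range (n + 2)).filter
      (fun s => s(waypoint u r n s, waypoint u r n (s + 1)) ∉ B) ⊆
      ({0} ∪ (Finset.range (n + 2)).filter fun s : ℕ => e + s < c) ∪
        (Finset.range (n + 2)).filter fun s : ℕ => e + s ∈ J := by
    intro s hs
    rw [Finset.mem_filter, Finset.mem_range] at hs
    simp only [Finset.mem_union, Finset.mem_singleton, Finset.mem_filter, Finset.mem_range]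
    rcases s with _ | s
    · exact Or.inl (Or.inl rfl)
    by_cases hc : e + ((s + 1 : ℕ) : ℤ) < c
    · exact Or.inl (Or.inr ⟨hs.1, hc⟩)
    refine Or.inr ⟨hs.1, ?_⟩
    have hcast : e + ((s + 1 : ℕ) : ℤ) = e + s + 1 := by push_cast; ring
    rw [hcast] at hc ⊢
    have hI : e + s + 1 ∈ Finset.Icc c t := by
      rw [Finset.mem_Icc]
      refine ⟨by omega, le_trans ?_ ht⟩
      rw [he, bottomScale]
      omega
    rw [hJ, Finset.mem_filter]
    refine ⟨hI, ?_, bottomScale_zpow_le hr (by omega)⟩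
    by_contra hcon
    refine hs.2 (mem_boughtEdges hn hr (by omega) hI ?_)
    refine le_trans ?_ (level_pred_le_aimLevel u n _)
    exact Nat.le_log_of_pow_le (by norm_num) (hm.trans (not_le.mp hcon).le)
  have hnn : ∀ s : ℕ, 0 ≤ 10 * (8 : ℝ) ^ (e + s) := fun s => by positivity
  have hunion : ∀ S T : Finset ℕ, ∑ s ∈ S ∪ T, 10 * (8 : ℝ) ^ (e + s)
      ≤ ∑ s ∈ S, 10 * (8 : ℝ) ^ (e + s) + ∑ s ∈ T, 10 * (8 : ℝ) ^ (e + s) := by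
    intro S T
    rw [← Finset.sum_union_inter]
    have : 0 ≤ ∑ s ∈ S ∩ T, 10 * (8 : ℝ) ^ (e + s) := Finset.sum_nonneg fun s _ => hnn s
    linarith
  refine (Finset.sum_le_sum_of_subset_of_nonneg hsub fun s _ _ => hnn s).trans ?_
  refine (hunion _ _).trans (add_le_add ((hunion _ _).trans (add_le_add ?_ ?_)) ?_)
  · rw [Finset.sum_singleton, Nat.cast_zero, add_zero]
    refine mul_le_mul_of_nonneg_left ?_ (by norm_num)
    have h1 := Int.zpow_log_le_self (b := 8) (by norm_num) (dist_pos.mpr hr)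
    push_cast at h1
    have h2 : (8 : ℝ) ^ e = (8 : ℝ) ^ Int.log 8 (dist (u n) r) * (1 / 8) ^ (n + 1) := by
      rw [he, bottomScale, zpow_sub₀ (by norm_num), div_eq_mul_inv, one_div, inv_pow]
      congr 2
    rw [h2]
    exact mul_le_mul_of_nonneg_right h1 (by positivity)
  · rw [← Finset.mul_sum]
    have := sum_zpow_lt_le e c (n + 2)
    have h0 : (0 : ℝ) < (8 : ℝ) ^ c := by positivity
    linarith
  · rw [← Finset.sum_image (f := fun i : ℤ => 10 * (8 : ℝ) ^ i) (g := fun s : ℕ => e + (s : ℤ))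
      (fun a _ b _ h => by simpa using h)]
    refine Finset.sum_le_sum_of_subset_of_nonneg (fun i hi => ?_) fun i _ _ => by positivity
    obtain ⟨s, hs, rfl⟩ := Finset.mem_image.mp hi
    exact (Finset.mem_filter.mp hs).2

lemma sum_eighth_pow_le (k : ℕ) : ∑ n ∈ Finset.range k, (1 / 8 : ℝ) ^ (n + 1) ≤ 1 / 7 := by
  suffices h : ∑ n ∈ Finset.range k, (1 / 8 : ℝ) ^ (n + 1) ≤ 1 / 7 - (1 / 8) ^ k / 7 by
    have : (0 : ℝ) < (1 / 8) ^ k := by positivity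
    linarith
  induction k with
  | zero => norm_num
  | succ k ih =>
    rw [Finset.sum_range_succ]
    have : (1 / 8 : ℝ) ^ (k + 1) = (1 / 8) ^ k / 8 := by rw [pow_succ]; ring
    linarith

/-- The number of relevant scales. -/
lemma card_scales_le {K : ℝ} (hK : 0 < K) (hk : 1 ≤ k) :
    (Finset.Icc (Int.log 8 (K / k)) (Int.log 8 (2 * K))).card ≤ Nat.log 2 k + 3 := by
  set L := Nat.log 2 k with hL
  rw [Int.card_Icc, Int.toNat_le]
  by_contra hcon
  push Not at hcon
  have hk0 : (0 : ℝ) < k := by exact_mod_cast hk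
  have h1 := Int.zpow_log_le_self (b := 8) (by norm_num) (by linarith : 0 < 2 * K)
  have h2 := Int.lt_zpow_succ_log_self (b := 8) (by norm_num) (K / k)
  push_cast at h1 h2 hcon
  have h3 : (8 : ℝ) ^ (Int.log 8 (K / k) + 1) * 8 ^ (L + 2) ≤ (8 : ℝ) ^ Int.log 8 (2 * K) := by
    rw [← zpow_natCast, ← zpow_add₀ (by norm_num)]
    refine zpow_le_zpow_right₀ (by norm_num) ?_
    push_cast
    omega
  have h4 : (k : ℝ) < 2 ^ (L + 1) := by
    exact_mod_cast Nat.lt_pow_succ_log_self (by norm_num : 1 < 2) k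
  have h5 : (2 : ℝ) ^ (L + 2) ≤ 8 ^ (L + 2) := pow_le_pow_left₀ (by norm_num) (by norm_num) _
  rw [div_lt_iff₀ hk0] at h2
  set x := (8 : ℝ) ^ (Int.log 8 (K / k) + 1) with hx
  have hx0 : 0 < x := by positivity
  have h6 : x * k < x * 2 ^ (L + 1) := mul_lt_mul_of_pos_left h4 hx0
  have h7 : x * 2 ^ (L + 2) ≤ x * 8 ^ (L + 2) := mul_le_mul_of_nonneg_left h5 hx0.le
  have h8 : x * 2 ^ (L + 2) = 2 * (x * 2 ^ (L + 1)) := by ring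
  linarith

/-- The competitive bound for the cost function `min · M`. -/
lemma cost_route_min_le (hP : ∀ s : Fin k, IsPath (u s) r (P s)) (hk : 1 ≤ k) {M : ℕ}
    (hM : 1 ≤ M) :
    costf (fun x => min x (M : ℝ)) (fun s : Fin k => route u r s)
      ≤ (480 * (Nat.log 2 k + 3) * (Nat.log 2 k + 1) * (Nat.sqrt (Nat.log 2 k) + 1)
          + 5120 * (Nat.log 2 k + 3) + 5) * costf (fun x => min x (M : ℝ)) P := by
  set K := costf (fun x => min x (M : ℝ)) P with hK
  set L := Nat.log 2 k with hL
  have hd : ∀ n < k, dist (u n) r ≤ 2 * K := fun n hn => dist_le_cost hP hM hn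
  have hK0 : 0 ≤ K := by
    have h1 := hd 0 hk
    have h2 := dist_nonneg (x := u 0) (y := r)
    linarith
  have hnil : ∀ n, u n = r → (edgeList (route u r n)).toFinset = ∅ := by
    intro n hn
    rw [route, if_pos hn]
    rfl
  rcases hK0.eq_or_lt with hK0' | hKpos
  · have hu : ∀ n < k, u n = r := fun n hn => by
      have := hd n hn
      rw [← hK0', mul_zero] at this
      exact dist_le_zero.mp this
    refine (cost_le_bought_add_rented _ _ (Nat.cast_nonneg M) ∅).trans ?_
    rw [← hK0', Finset.sum_empty, mul_zero, mul_zero, zero_add]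
    refine (Finset.sum_eq_zero fun s _ => ?_).le
    rw [hnil s (hu s s.2), Finset.empty_sdiff, Finset.sum_empty]
  have hk0 : (0 : ℝ) < k := by exact_mod_cast hk
  set m := Nat.log 2 M with hm
  have hmM : 2 ^ m ≤ M := Nat.pow_log_le_self 2 (by omega)
  have hMm : M ≤ 2 ^ (m + 1) := (Nat.lt_pow_succ_log_self (by norm_num) M).le
  set c := Int.log 8 (K / k) with hc
  set t := Int.log 8 (2 * K) with ht
  have hcK : (8 : ℝ) ^ c ≤ K / k := by
    have := Int.zpow_log_le_self (b := 8) (by norm_num) (div_pos hKpos hk0)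
    exact_mod_cast this
  have hcard : ((Finset.Icc c t).card : ℝ) ≤ L + 3 := by
    exact_mod_cast card_scales_le hKpos hk
  refine (cost_le_bought_add_rented _ _ (Nat.cast_nonneg M)
    (boughtEdges u r k L m (Finset.Icc c t))).trans ?_
  have hbuy : (M : ℝ) * ∑ e ∈ boughtEdges u r k L m (Finset.Icc c t), edgeLen e
      ≤ 480 * (L + 3) * (L + 1) * (Nat.sqrt L + 1) * K := by
    refine (sum_boughtEdges_le hP hmM hMm _).trans ?_
    rw [← hK]
    gcongr
  have hrent : ∀ n < k, ∑ e ∈ (edgeList (route u r n)).toFinset \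
        boughtEdges u r k L m (Finset.Icc c t), edgeLen e
      ≤ 20 * K * (1 / 8) ^ (n + 1) + 2 * (K / k)
        + ∑ i ∈ Finset.Icc c t, if nearCount u n (i - 1) ≤ M ∧
            (8 : ℝ) ^ i ≤ dist (u n) r then 10 * (8 : ℝ) ^ i else 0 := by
    intro n hn
    by_cases hr : u n = r
    · rw [hnil n hr, Finset.empty_sdiff, Finset.sum_empty]
      refine add_nonneg (by positivity) (Finset.sum_nonneg fun i _ => ?_)
      split_ifs
      · positivity
      · exact le_rfl
    · rw [← Finset.sum_filter]
      refine (rent_le hn hr hmM (Int.log_mono_right (dist_pos.mpr hr) (hd n hn))).trans ?_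
      have h1 : dist (u n) r * (1 / 8) ^ (n + 1) ≤ 2 * K * (1 / 8) ^ (n + 1) :=
        mul_le_mul_of_nonneg_right (hd n hn) (by positivity)
      refine add_le_add (add_le_add ?_ ?_) le_rfl <;> linarith
  have hsum : ∑ s : Fin k, ∑ e ∈ (edgeList (route u r s)).toFinset \
      boughtEdges u r k L m (Finset.Icc c t), edgeLen e ≤ 5 * K + (L + 3) * (5120 * K) := by
    rw [Fin.sum_univ_eq_sum_range (fun n => ∑ e ∈ (edgeList (route u r n)).toFinset \
      boughtEdges u r k L m (Finset.Icc c t), edgeLen e) k]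
    refine (Finset.sum_le_sum fun n hn => hrent n (Finset.mem_range.mp hn)).trans ?_
    rw [Finset.sum_add_distrib, Finset.sum_add_distrib, ← Finset.mul_sum, Finset.sum_const,
      Finset.card_range, nsmul_eq_mul, Finset.sum_comm]
    have h1 := mul_le_mul_of_nonneg_left (sum_eighth_pow_le k) (by positivity : 0 ≤ 20 * K)
    have h2 : (k : ℝ) * (2 * (K / k)) = 2 * K := by field_simp
    have h3 : ∑ i ∈ Finset.Icc c t, ∑ n ∈ Finset.range k, (if nearCount u n (i - 1) ≤ M ∧
        (8 : ℝ) ^ i ≤ dist (u n) r then 10 * (8 : ℝ) ^ i else 0)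
        ≤ (Finset.Icc c t).card • (5120 * K) := by
      refine Finset.sum_le_card_nsmul _ _ _ fun i _ => ?_
      rw [← Finset.sum_filter, Finset.sum_const, nsmul_eq_mul]
      have := card_sparse_mul_le hP (M := M) i
      rw [← hK] at this
      linarith
    rw [nsmul_eq_mul] at h3
    have h4 := mul_le_mul_of_nonneg_right hcard (by positivity : 0 ≤ 5120 * K)
    linarith
  linarith

end Rent

/-- **Theorem 3 (Deterministic oblivious online buy-at-bulk).**
There is a universal constant `C` such that for every metric space `X` and root
`r` there is a deterministic online routing algorithm such that, for every
sequence of `k ≥ 1` terminals and every nondecreasing concave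
`f : [0,∞) → [0,∞)` with `f 0 = 0`, the cost of the produced routing is at most
`C·(1 + log₂ k)^{5/2}·OPT_f`. -/
theorem deterministic_oblivious_buy_at_bulk :
    ∃ C : ℝ, 0 < C ∧
      ∀ (X : Type) [MetricSpace X] (r : X),
        ∃ A : List X → List X,
          -- `A` is an online routing algorithm: on a prefix ending at `x`
          -- it produces a path from `x` to `r`
          (∀ (l : List X) (x : X), IsPath x r (A (l ++ [x]))) ∧
          ∀ (k : ℕ), 1 ≤ k → ∀ v : Fin k → X,
            ∀ f : ℝ → ℝ,
              MonotoneOn f (Set.Ici 0) → ConcaveOn ℝ (Set.Ici 0) f → f 0 = 0 →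
              costf f (fun s : Fin k => A ((List.ofFn v).take (↑s + 1)))
                ≤ C * (1 + Real.logb 2 (k : ℝ)) ^ ((5 : ℝ) / 2) * OPTf f v r := by
  refine ⟨40000, by norm_num, fun X _ r => ⟨fun l => route (fun j => l.getD j r) r (l.length - 1),
    fun l x => ?_, ?_⟩⟩
  · have h := isPath_route (fun j => (l ++ [x]).getD j r) r ((l ++ [x]).length - 1)
    simpa using h
  intro k hk v f hmono hconc h0
  set u : ℕ → X := fun j => (List.ofFn v).getD j r with hu
  have hA : (fun s : Fin k => route (fun j => ((List.ofFn v).take (s + 1)).getD j r) r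
      (((List.ofFn v).take (s + 1)).length - 1)) = fun s : Fin k => route u r s := by
    funext s
    have hs := s.2
    have hlen : ((List.ofFn v).take (s + 1)).length - 1 = s := by
      rw [List.length_take, List.length_ofFn]
      omega
    rw [hlen]
    refine route_congr fun j hj => ?_
    simp only [hu, List.getD_eq_getElem?_getD]
    rw [List.getElem?_take_of_lt (by omega)]
  have huv : ∀ s : Fin k, u s = v s := fun s => by simp [hu]
  set y : ℝ := 1 + Real.logb 2 k with hy
  have hL : (Nat.log 2 k : ℝ) + 1 ≤ y := by
    have := Real.natLog_le_logb k 2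
    push_cast at this
    linarith
  have hL0 : (0 : ℝ) ≤ Nat.log 2 k := Nat.cast_nonneg _
  have hy1 : 1 ≤ y := by linarith
  have hy5 : y ^ ((5 : ℝ) / 2) = y ^ 2 * √y := by
    rw [Real.sqrt_eq_rpow, ← Real.rpow_natCast, ← Real.rpow_add (by linarith)]
    norm_num
  have hs1 : 1 ≤ √y := Real.one_le_sqrt.mpr hy1
  have hfac : (480 * (Nat.log 2 k + 3) * (Nat.log 2 k + 1) * (Nat.sqrt (Nat.log 2 k) + 1)
      + 5120 * (Nat.log 2 k + 3) + 5 : ℝ) ≤ 40000 * y ^ ((5 : ℝ) / 2) := by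
    have hsq : (Nat.sqrt (Nat.log 2 k) : ℝ) ≤ √y :=
      Real.nat_sqrt_le_real_sqrt.trans (Real.sqrt_le_sqrt (by linarith))
    have h1 : (480 * (Nat.log 2 k + 3) * (Nat.log 2 k + 1) * (Nat.sqrt (Nat.log 2 k) + 1) : ℝ)
        ≤ 480 * (3 * y) * y * (2 * √y) := by
      gcongr <;> linarith
    have h2 : y ≤ y ^ 2 * √y := by nlinarith
    rw [hy5]
    linarith
  have hmin : ∀ P : Fin k → List X, (∀ s, IsPath (v s) r (P s)) →
      costf f (fun s : Fin k => route u r s) ≤ 40000 * y ^ ((5 : ℝ) / 2) * costf f P := by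
    intro P hP
    obtain ⟨c, hc0, hc⟩ := exists_min_decomposition k f hmono hconc h0
    have hdec : ∀ Q : Fin k → List X, costf f Q
        = ∑ j ∈ Finset.range k, c j * costf (fun x => min x ((j + 1 : ℕ) : ℝ)) Q := by
      intro Q
      simp only [costf, Finset.mul_sum]
      rw [Finset.sum_comm]
      refine Finset.sum_congr rfl fun e _ => ?_
      rw [hc _ (load_le Q e), Finset.mul_sum]
      exact Finset.sum_congr rfl fun j _ => mul_left_comm _ _ _
    rw [hdec, hdec, Finset.mul_sum]
    refine Finset.sum_le_sum fun j _ => ?_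
    rw [mul_left_comm]
    refine mul_le_mul_of_nonneg_left ?_ (hc0 j)
    have hP' : ∀ s : Fin k, IsPath (u s) r (P s) := fun s => by
      rw [huv]
      exact hP s
    refine (cost_route_min_le hP' hk (by omega : 1 ≤ j + 1)).trans
      (mul_le_mul_of_nonneg_right hfac ?_)
    refine Finset.sum_nonneg fun e _ => mul_nonneg (edgeLen_nonneg e) ?_
    exact le_min (Nat.cast_nonneg _) (Nat.cast_nonneg _)
  have hpos : 0 < 40000 * y ^ ((5 : ℝ) / 2) := by positivity
  rw [hA, mul_comm, ← div_le_iff₀ hpos]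
  refine le_csInf ⟨_, fun s => [v s, r], fun s => ⟨rfl, rfl⟩, rfl⟩ ?_
  rintro _ ⟨P, hP, rfl⟩
  rw [div_le_iff₀ hpos, mul_comm]
  exact hmin P hP
end
end

section
/- Let M ≥ 1 and let σ_0, σ_1, …, σ_M and β_0, β_1, …, β_M be positive reals with σ_i ≥ 3·σ_{i-1} and β_i ≤ β_{i-1}/9 for every i ∈ {1,…,M}. Let E be a finite set, let ℓ : E → [0,∞) and n : E → ℕ. Then Σ_{i=1}^{M} Σ_{e∈E} ℓ(e)·min(σ_i, β_{i-1}·n(e)) ≤ (3/2)·Σ_{e∈E} ℓ(e)·min_{1 ≤ j ≤ M} (σ_j + β_j·n(e)). -/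
/-- A sequence growing by a factor of at least `3` has partial sums at most `3 / 2` times
the last term. -/
theorem sum_Icc_le_of_three_mul_le {M : ℕ} {σ : ℕ → ℝ} (h0 : 0 ≤ σ 0)
    (hσ : ∀ i, 1 ≤ i → i ≤ M → 3 * σ (i - 1) ≤ σ i) {k : ℕ} (hk : k ≤ M) :
    ∑ i ∈ Finset.Icc 1 k, σ i ≤ 3 / 2 * σ k := by
  induction k with
  | zero => simpa using h0
  | succ k ih =>
    rw [Finset.sum_Icc_succ_top (by omega)]
    have hstep := hσ (k + 1) (by omega) hk
    rw [Nat.add_sub_cancel] at hstep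
    linarith [ih (by omega)]

/-- Total rent-or-buy cost of the first `k` cable types, bounded through cable type `j ≤ k`:
types up to `j` are bought, later ones are rented. -/
theorem sum_min_le_of_le {M : ℕ} {σ β : ℕ → ℝ} (h0 : 0 ≤ σ 0)
    (hσ : ∀ i, 1 ≤ i → i ≤ M → 3 * σ (i - 1) ≤ σ i)
    (hβ : ∀ i, 1 ≤ i → i ≤ M → β i ≤ β (i - 1) / 9)
    {x : ℝ} (hx : 0 ≤ x) {j k : ℕ} (hjk : j ≤ k) (hk : k ≤ M) :
    ∑ i ∈ Finset.Icc 1 k, min (σ i) (β (i - 1) * x)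
      ≤ 3 / 2 * σ j + 9 / 8 * (β j * x - β k * x) := by
  induction k, hjk using Nat.le_induction with
  | base =>
    have hbuy := Finset.sum_le_sum fun i (_ : i ∈ Finset.Icc 1 j) =>
      min_le_left (σ i) (β (i - 1) * x)
    linarith [sum_Icc_le_of_three_mul_le h0 hσ hk]
  | succ k hjk ih =>
    rw [Finset.sum_Icc_succ_top (by omega), Nat.add_sub_cancel]
    have hstep := mul_le_mul_of_nonneg_right (hβ (k + 1) (by omega) hk) hx
    rw [Nat.add_sub_cancel] at hstep
    linarith [ih (by omega), min_le_right (σ (k + 1)) (β k * x)]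


/-- **Lemma 2 (OPT decomposition on trees), per-edge form.**
Given `M ≥ 1` cable types with positive fixed costs `σ_0, …, σ_M` increasing
geometrically (factor ≥ 3) and positive incremental costs `β_0, …, β_M`
decreasing geometrically (factor ≤ 1/9), a finite edge set `E` with nonnegative
lengths `ℓ` and loads `n`, the total rent-or-buy cost over all cable types is at
most `3/2` times the optimal buy-at-bulk cost:
`∑_{i=1}^M ∑_{e∈E} ℓ(e)·min(σ_i, β_{i-1}·n(e))
  ≤ (3/2) · ∑_{e∈E} ℓ(e)·min_{1≤j≤M}(σ_j + β_j·n(e))`. -/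
theorem opt_decomposition_on_trees {α : Type} (M : ℕ) (hM : 1 ≤ M)
    (σ β : ℕ → ℝ)
    (hσpos : ∀ i ≤ M, 0 < σ i) (hβpos : ∀ i ≤ M, 0 < β i)
    (hσ : ∀ i, 1 ≤ i → i ≤ M → 3 * σ (i - 1) ≤ σ i)
    (hβ : ∀ i, 1 ≤ i → i ≤ M → β i ≤ β (i - 1) / 9)
    (E : Finset α) (ℓ : α → ℝ) (hℓ : ∀ e ∈ E, 0 ≤ ℓ e) (n : α → ℕ) :
    ∑ i ∈ Finset.Icc 1 M, ∑ e ∈ E, ℓ e * min (σ i) (β (i - 1) * (n e : ℝ))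
      ≤ (3 / 2) *
          ∑ e ∈ E, ℓ e *
            (Finset.Icc 1 M).inf' (Finset.nonempty_Icc.mpr hM)
              (fun j => σ j + β j * (n e : ℝ)) := by
  rw [Finset.sum_comm, Finset.mul_sum]
  refine Finset.sum_le_sum fun e he => ?_
  obtain ⟨j, hj, hmin⟩ := Finset.exists_mem_eq_inf' (Finset.nonempty_Icc.mpr hM)
    (fun j => σ j + β j * (n e : ℝ))
  have hjM := (Finset.mem_Icc.mp hj).2
  have hbound := sum_min_le_of_le (hσpos 0 (Nat.zero_le M)).le hσ hβ
    (Nat.cast_nonneg (α := ℝ) (n e)) hjM le_rfl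
  have hβj := mul_nonneg (hβpos j hjM).le (Nat.cast_nonneg (α := ℝ) (n e))
  have hβM := mul_nonneg (hβpos M le_rfl).le (Nat.cast_nonneg (α := ℝ) (n e))
  rw [hmin, ← Finset.mul_sum, mul_left_comm]
  exact mul_le_mul_of_nonneg_left (by linarith) (hℓ e he)
end
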